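/- arXiv:2410.05532 — 2 statements merged into one kernel-verified Lean document; each statement's English description precedes it below -/
import Mathlib

section
/- Let (E, g^E) be a holomorphic Hermitian G-equivariant vector bundle over a tamed Kähler G-manifold (M, g^M). Then the set 𝓕(M, g^M, E, g^E) of admissible functions is nonempty: there exists a smooth function s: [0,∞) → [0,∞) with s' > 0 everywhere such that f(x) = s'(|μ(x)|²/2) satisfies lim_{M ∋ x → ∞} f²|v|² / (|df||v| + fν + 1) = ∞. -/
open Filter Topology

noncomputable section

/-- The scalar data of a *tamed Kähler `G`-manifold* `(M, g^M)` (Definition 2.2 of the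
paper) together with a `G`-equivariant holomorphic Hermitian vector bundle `(E, g^E)` over
it:  `musq x = |μ(x)|²/2`, where `μ : M → 𝔤*` is the (proper) moment map;
`vnorm x = |v(x)|` is the norm of the Hamiltonian vector field `v = -J∇(|μ|²/2)`;
`dmusqnorm x = |d(|μ|²/2)(x)|`;  and `nu = |𝐯| + ‖∇^{LC}v‖ + ‖μ^ℰ(𝐯)‖ + |v| + 1` is the
function (2.7) of the paper (built from the bundle `ℰ = E ⊗ Λ(T^{0,1}M)*` and its metric).
Kähler geometry and vector bundles are not available in Mathlib, so these scalar functions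
are recorded as abstract data, together with the properties used in the paper. -/
structure TamedData where
  /-- the underlying (complete Kähler) manifold -/
  M : Type*
  [topM : TopologicalSpace M]
  /-- `x ↦ |μ(x)|²/2` -/
  musq : M → ℝ
  /-- `x ↦ |v(x)|`, the norm of the Hamiltonian vector field of `|μ|²/2` -/
  vnorm : M → ℝ
  /-- `x ↦ |d(|μ|²/2)(x)|` -/
  dmusqnorm : M → ℝ
  /-- `ν = |𝐯| + ‖∇^{LC}v‖ + ‖μ^ℰ(𝐯)‖ + |v| + 1`, cf. (2.7) of the paper -/
  nu : M → ℝ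
  musq_nonneg : ∀ x, 0 ≤ musq x
  vnorm_nonneg : ∀ x, 0 ≤ vnorm x
  dmusqnorm_nonneg : ∀ x, 0 ≤ dmusqnorm x
  nu_ge : ∀ x, vnorm x + 1 ≤ nu x
  continuous_musq : Continuous musq
  continuous_vnorm : Continuous vnorm
  continuous_dmusqnorm : Continuous dmusqnorm
  continuous_nu : Continuous nu
  /-- the moment map `μ` is proper -/
  proper_musq : Tendsto musq (cocompact M) atTop
  /-- the vector field `v` does not vanish outside of a compact set -/
  tamed : ∃ K : Set M, IsCompact K ∧ ∀ x ∉ K, vnorm x ≠ 0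

attribute [instance] TamedData.topM

namespace TamedData

variable (S : TamedData)

/-- `f(x) = s'(|μ(x)|²/2)`, cf. (2.8) of the paper. -/
def ffun (s : ℝ → ℝ) (x : S.M) : ℝ := deriv s (S.musq x)

/-- `|df(x)| = |s''(|μ(x)|²/2)| ⬝ |d(|μ|²/2)(x)|` (the norm of the differential of `ffun`). -/
def dfnorm (s : ℝ → ℝ) (x : S.M) : ℝ := |deriv (deriv s) (S.musq x)| * S.dmusqnorm x

/-- Definition 2.4 of the paper (Definition 4.8 of [BrBackground]): a smooth function
`s : [0,∞) → [0,∞)` with `s' > 0` is *admissible* for the quadruple `(M, g^M, E, g^E)` if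
the function `f = s'(|μ|²/2)` satisfies
`lim_{M ∋ x → ∞} f²|v|² / (|df||v| + fν + 1) = ∞`. -/
def Admissible (s : ℝ → ℝ) : Prop :=
  ContDiff ℝ (⊤ : ℕ∞) s ∧ (∀ r : ℝ, 0 ≤ r → 0 ≤ s r) ∧
    (∀ r : ℝ, 0 ≤ r → 0 < deriv s r) ∧
    Tendsto
      (fun x : S.M => (S.ffun s x) ^ 2 * (S.vnorm x) ^ 2 /
        (S.dfnorm s x * S.vnorm x + S.ffun s x * S.nu x + 1))
      (cocompact S.M) atTop

end TamedData

/-- A smooth positive function lying below `exp (-t) / B t`, for `B` monotone. -/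
theorem exists_contDiff_pos_le_exp_neg_div {B : ℝ → ℝ} (hB : Monotone B) (hB1 : ∀ t, 1 ≤ B t) :
    ∃ h : ℝ → ℝ, ContDiff ℝ (⊤ : ℕ∞) h ∧ ∀ t, 0 < h t ∧ h t ≤ Real.exp (-t) / B t := by
  obtain ⟨h, hh⟩ := exists_contMDiffMap_forall_mem_convex_of_local_const (n := (⊤ : ℕ∞))
    (modelWithCornersSelf ℝ ℝ) (t := fun t : ℝ => Set.Ioc 0 (Real.exp (-t) / B t))
    (fun t => convex_Ioc _ _) (fun t => by
      refine ⟨Real.exp (-(t + 1)) / B (t + 1), ?_⟩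
      filter_upwards [Iio_mem_nhds (lt_add_one t)] with y hy
      have h0 : 0 < B y := one_pos.trans_le (hB1 y)
      have h1 : 0 < B (t + 1) := one_pos.trans_le (hB1 _)
      have h2 : B y ≤ B (t + 1) := hB (le_of_lt hy)
      have h3 : -(t + 1) ≤ -y := neg_le_neg (le_of_lt hy)
      exact ⟨by positivity, by gcongr⟩)
  exact ⟨h, h.contMDiff.contDiff, fun t => hh t⟩

/-- A smooth positive function which, together with its derivative, is at most
`exp (-t) / B t`, for `B` monotone. -/
theorem exists_contDiff_pos_deriv_le_exp_neg_div {B : ℝ → ℝ} (hB : Monotone B)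
    (hB1 : ∀ t, 1 ≤ B t) :
    ∃ g : ℝ → ℝ, ContDiff ℝ (⊤ : ℕ∞) g ∧
      ∀ t, 0 < g t ∧ g t ≤ Real.exp (-t) / B t ∧ |deriv g t| ≤ Real.exp (-t) / B t := by
  obtain ⟨h, hsm, hh⟩ := exists_contDiff_pos_le_exp_neg_div hB hB1
  have hint : ∀ r, MeasureTheory.IntegrableOn h (Set.Ioi r) := fun r => by
    refine (integrableOn_exp_neg_Ioi r).mono' hsm.continuous.aestronglyMeasurable
      (Eventually.of_forall fun t => ?_)
    rw [Real.norm_of_nonneg (hh t).1.le]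
    exact (hh t).2.trans (div_le_self (Real.exp_pos _).le (hB1 t))
  have hg : ∀ r, HasDerivAt (fun r => ∫ t in Set.Ioi r, h t) (-h r) r := fun r => by
    have h1 : (fun r => ∫ t in Set.Ioi r, h t)
        = fun r => (∫ t in Set.Ioi 0, h t) - ∫ t in (0 : ℝ)..r, h t := by
      funext r
      rw [← intervalIntegral.integral_Ioi_sub_Ioi' (hint 0) (hint r)]
      ring
    rw [h1]
    exact (hsm.continuous.integral_hasStrictDerivAt 0 r).hasDerivAt.const_sub _
  have hd : deriv (fun r => ∫ t in Set.Ioi r, h t) = fun r => -h r := funext fun r => (hg r).deriv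
  refine ⟨fun r => ∫ t in Set.Ioi r, h t, ?_, fun r => ⟨?_, ?_, ?_⟩⟩
  · exact contDiff_infty_iff_deriv.2 ⟨fun r => (hg r).differentiableAt, hd ▸ hsm.neg⟩
  · refine (MeasureTheory.setIntegral_pos_iff_support_of_nonneg_ae
      (Eventually.of_forall fun t => (hh t).1.le) (hint r)).2 ?_
    rw [show Function.support h = Set.univ from Set.eq_univ_of_forall fun t => (hh t).1.ne']
    simp
  · have h0 : 0 < B r := one_pos.trans_le (hB1 r)
    calc ∫ t in Set.Ioi r, h t ≤ ∫ t in Set.Ioi r, Real.exp (-t) / B r := by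
          refine MeasureTheory.setIntegral_mono_on (hint r)
            ((integrableOn_exp_neg_Ioi r).div_const _) measurableSet_Ioi fun t ht => ?_
          have := hB (le_of_lt (Set.mem_Ioi.1 ht))
          exact (hh t).2.trans (by gcongr)
      _ = Real.exp (-r) / B r := by
          rw [MeasureTheory.integral_div, integral_exp_neg_Ioi]
  · rw [hd, abs_neg, abs_of_pos (hh r).1]
    exact (hh r).2

namespace TamedData

/-- Sublevel sets of `|μ|²/2` are compact. -/
theorem isCompact_musq_le (S : TamedData) (r : ℝ) : IsCompact {x | S.musq x ≤ r} := by
  obtain ⟨K, hK, hsub⟩ := mem_cocompact.1 (S.proper_musq (Ioi_mem_atTop r))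
  refine hK.of_isClosed_subset (isClosed_le S.continuous_musq continuous_const) fun x hx => ?_
  by_contra hxK
  exact not_lt.2 (show S.musq x ≤ r from hx) (show r < S.musq x from hsub hxK)

/-- Outside a compact set, `|d(|μ|²/2)|` and `ν` are bounded by `|v|` and `|v|²` up to a factor
that is a monotone function of `|μ|²/2`. -/
theorem exists_monotone_bound (S : TamedData) :
    ∃ B : ℝ → ℝ, Monotone B ∧ (∀ t, 1 ≤ B t) ∧ ∀ᶠ x in cocompact S.M,
      S.dmusqnorm x ≤ B (S.musq x) * S.vnorm x ∧ S.nu x ≤ B (S.musq x) * S.vnorm x ^ 2 := by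
  obtain ⟨K, hK, hv⟩ := S.tamed
  obtain ⟨R, hR⟩ := hK.bddAbove_image S.continuous_musq.continuousOn
  have hvne : ∀ x, R + 1 ≤ S.musq x → S.vnorm x ≠ 0 := fun x hx => hv x fun hxK => by
    have := hR (Set.mem_image_of_mem _ hxK)
    linarith
  have hC : ∀ n : ℕ, ∃ C : ℝ, ∀ x, R + 1 ≤ S.musq x → S.musq x ≤ n + 1 →
      S.dmusqnorm x / S.vnorm x ≤ C ∧ S.nu x / S.vnorm x ^ 2 ≤ C := fun n => by
    have hc : IsCompact {x | S.musq x ≤ n + 1 ∧ R + 1 ≤ S.musq x} :=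
      (S.isCompact_musq_le (n + 1)).inter_right (isClosed_le continuous_const S.continuous_musq)
    obtain ⟨C₁, h₁⟩ := hc.bddAbove_image (f := fun x => S.dmusqnorm x / S.vnorm x)
      (S.continuous_dmusqnorm.continuousOn.div S.continuous_vnorm.continuousOn
        fun x hx => hvne x hx.2)
    obtain ⟨C₂, h₂⟩ := hc.bddAbove_image (f := fun x => S.nu x / S.vnorm x ^ 2)
      (S.continuous_nu.continuousOn.div (S.continuous_vnorm.pow 2).continuousOn
        fun x hx => pow_ne_zero 2 (hvne x hx.2))
    exact ⟨max C₁ C₂, fun x hx hx' =>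
      ⟨(h₁ (Set.mem_image_of_mem _ ⟨hx', hx⟩)).trans (le_max_left _ _),
        (h₂ (Set.mem_image_of_mem _ ⟨hx', hx⟩)).trans (le_max_right _ _)⟩⟩
  choose C hC using hC
  have hsum : ∀ n : ℕ, max (C n) 1 ≤ ∑ i ∈ Finset.range (n + 1), max (C i) 1 := fun n =>
    Finset.single_le_sum (f := fun i => max (C i) 1)
      (fun i _ => zero_le_one.trans (le_max_right _ _)) (Finset.self_mem_range_succ n)
  refine ⟨fun t => ∑ i ∈ Finset.range (⌊t⌋₊ + 1), max (C i) 1, fun a b hab => ?_,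
    fun t => (le_max_right _ _).trans (hsum _), ?_⟩
  · refine Finset.sum_le_sum_of_subset_of_nonneg ?_
      fun i _ _ => zero_le_one.trans (le_max_right _ _)
    exact Finset.range_subset_range.2 (Nat.succ_le_succ (Nat.floor_mono hab))
  · filter_upwards [S.proper_musq (Ici_mem_atTop (R + 1))] with x hx
    have hpos : 0 < S.vnorm x := (S.vnorm_nonneg x).lt_of_ne' (hvne x hx)
    have hle := (le_max_left _ _).trans (hsum ⌊S.musq x⌋₊)
    obtain ⟨h₁, h₂⟩ := hC ⌊S.musq x⌋₊ x hx (Nat.lt_floor_add_one _).le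
    exact ⟨(div_le_iff₀ hpos).1 (h₁.trans hle), (div_le_iff₀ (pow_pos hpos 2)).1 (h₂.trans hle)⟩

end TamedData

/-!
STATEMENT 1 (first half of Lemma 2.5 of the paper = Lemma 4.12 of [BrBackground]):
for a holomorphic Hermitian `G`-equivariant vector bundle `(E, g^E)` over a tamed Kähler
`G`-manifold `(M, g^M)`, the set `𝓕(M, g^M, E, g^E)` of admissible functions is nonempty.
-/

theorem admissible_exists (S : TamedData) : ∃ s : ℝ → ℝ, S.Admissible s := by
  obtain ⟨B, hB, hB1, hbound⟩ := S.exists_monotone_bound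
  obtain ⟨g, hgs, hg⟩ := exists_contDiff_pos_deriv_le_exp_neg_div hB hB1
  have hfs : ContDiff ℝ (⊤ : ℕ∞) (fun t => (g t)⁻¹) := hgs.inv fun t => (hg t).1.ne'
  have hs : ∀ r, HasDerivAt (fun r => ∫ t in (0 : ℝ)..r, (g t)⁻¹) (g r)⁻¹ r := fun r =>
    (hfs.continuous.integral_hasStrictDerivAt 0 r).hasDerivAt
  have hd : deriv (fun r => ∫ t in (0 : ℝ)..r, (g t)⁻¹) = fun r => (g r)⁻¹ :=
    funext fun r => (hs r).deriv
  refine ⟨fun r => ∫ t in (0 : ℝ)..r, (g t)⁻¹, ?_, fun r hr => ?_, fun r _ => ?_, ?_⟩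
  · exact contDiff_infty_iff_deriv.2 ⟨fun r => (hs r).differentiableAt, by rwa [hd]⟩
  · exact intervalIntegral.integral_nonneg hr fun t _ => (inv_pos.2 (hg t).1).le
  · rw [hd]
    exact inv_pos.2 (hg r).1
  · have hexp : Tendsto (fun x : S.M => Real.exp (S.musq x) / 3) (cocompact S.M) atTop :=
      (Real.tendsto_exp_atTop.comp S.proper_musq).atTop_div_const (by norm_num)
    refine tendsto_atTop_mono' _ ?_ hexp
    filter_upwards [hbound] with x hx
    have hdd : deriv (fun r => (g r)⁻¹) (S.musq x) = -deriv g (S.musq x) / g (S.musq x) ^ 2 :=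
      deriv_fun_inv'' (hgs.differentiable (by simp) _) (hg _).1.ne'
    simp only [TamedData.ffun, TamedData.dfnorm, hd, hdd]
    obtain ⟨hg0, hgB, hg'⟩ := hg (S.musq x)
    obtain ⟨hdB, hnB⟩ := hx
    have hm := S.musq_nonneg x
    have hv := S.vnorm_nonneg x
    have hD := S.dmusqnorm_nonneg x
    have hn := S.nu_ge x
    have hb := hB1 (S.musq x)
    generalize S.musq x = m at *
    generalize S.vnorm x = v at *
    generalize S.dmusqnorm x = D at *
    generalize S.nu x = n at *
    generalize g m = c at *
    generalize deriv g m = c' at *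
    generalize B m = b at *
    have hb0 : 0 < b := one_pos.trans_le hb
    have he : Real.exp (-m) ≤ 1 := Real.exp_le_one_iff.2 (neg_nonpos.2 hm)
    have hcb : c * b ≤ Real.exp (-m) := (le_div_iff₀ hb0).1 hgB
    have hcb' : |c'| * b ≤ Real.exp (-m) := (le_div_iff₀ hb0).1 hg'
    have hc1 : c ≤ 1 := by nlinarith
    have h₁ : |c'| * D * v ≤ Real.exp (-m) * v ^ 2 :=
      calc |c'| * D * v ≤ |c'| * (b * v) * v := by gcongr
        _ = |c'| * b * v ^ 2 := by ring
        _ ≤ _ := by gcongr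
    have h₂ : c * n ≤ Real.exp (-m) * v ^ 2 :=
      calc c * n ≤ c * (b * v ^ 2) := by gcongr
        _ = c * b * v ^ 2 := by ring
        _ ≤ _ := by gcongr
    have hn0 : 0 < n := by linarith
    have h₃ : c ^ 2 ≤ c * n := by nlinarith
    have hden : |-c' / c ^ 2| * D * v + c⁻¹ * n + 1 = (|c'| * D * v + c * n + c ^ 2) / c ^ 2 := by
      rw [abs_div, abs_neg, abs_of_pos (pow_pos hg0 2)]
      field_simp
    have hpos : 0 < |c'| * D * v + c * n + c ^ 2 := by positivity
    rw [hden, inv_pow, inv_mul_eq_div, div_div_div_cancel_right₀ (pow_ne_zero 2 hg0.ne'),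
      le_div_iff₀ hpos]
    calc Real.exp m / 3 * (|c'| * D * v + c * n + c ^ 2)
        ≤ Real.exp m / 3 * (3 * (Real.exp (-m) * v ^ 2)) := by
          gcongr
          linarith
      _ = Real.exp m * Real.exp (-m) * v ^ 2 := by ring
      _ = v ^ 2 := by rw [← Real.exp_add, add_neg_cancel, Real.exp_zero, one_mul]
end
end

section
/- Let (E, g^E) be a holomorphic Hermitian G-equivariant vector bundle over a tamed Kähler G-manifold (M, g^M). If s₁, s₂ ∈ 𝓕(M, g^M, E, g^E) are admissible functions, then for any positive real numbers t₁, t₂ > 0 the function s := t₁s₁ + t₂s₂ is admissible. In particular, the set 𝓕(M, g^M, E, g^E) of admissible functions is a convex cone. -/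
open Filter Topology

noncomputable section

/-!
STATEMENT 2 (second half of Lemma 2.5 of the paper = Lemma 4.11 of [BrBackground]):
if `s₁, s₂ ∈ 𝓕(M, g^M, E, g^E)` are admissible functions, then for any positive real
numbers `t₁, t₂ > 0` the function `s := t₁s₁ + t₂s₂` is admissible.  In particular the set
`𝓕(M, g^M, E, g^E)` of admissible functions is a convex cone.
-/

theorem deriv_linear_combination {s₁ s₂ : ℝ → ℝ} (h₁ : Differentiable ℝ s₁)
    (h₂ : Differentiable ℝ s₂) (t₁ t₂ : ℝ) :
    deriv (fun r => t₁ * s₁ r + t₂ * s₂ r) = fun r => t₁ * deriv s₁ r + t₂ * deriv s₂ r :=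
  funext fun r =>
    (((h₁ r).hasDerivAt.const_mul t₁).add ((h₂ r).hasDerivAt.const_mul t₂)).deriv

namespace TamedData

theorem dfnorm_nonneg (S : TamedData) (s : ℝ → ℝ) (x : S.M) : 0 ≤ S.dfnorm s x :=
  mul_nonneg (abs_nonneg _) (S.dmusqnorm_nonneg x)

theorem nu_nonneg (S : TamedData) (x : S.M) : 0 ≤ S.nu x := by
  linarith [S.nu_ge x, S.vnorm_nonneg x]

theorem ffun_linear_combination (S : TamedData) {s₁ s₂ : ℝ → ℝ} (h₁ : Differentiable ℝ s₁)
    (h₂ : Differentiable ℝ s₂) (t₁ t₂ : ℝ) (x : S.M) :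
    S.ffun (fun r => t₁ * s₁ r + t₂ * s₂ r) x = t₁ * S.ffun s₁ x + t₂ * S.ffun s₂ x :=
  congrFun (deriv_linear_combination h₁ h₂ t₁ t₂) _

theorem dfnorm_linear_combination_le (S : TamedData) {s₁ s₂ : ℝ → ℝ}
    (h₁ : Differentiable ℝ s₁) (h₂ : Differentiable ℝ s₂)
    (h₁' : Differentiable ℝ (deriv s₁)) (h₂' : Differentiable ℝ (deriv s₂))
    {t₁ t₂ : ℝ} (ht₁ : 0 ≤ t₁) (ht₂ : 0 ≤ t₂) (x : S.M) :
    S.dfnorm (fun r => t₁ * s₁ r + t₂ * s₂ r) x ≤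
      t₁ * S.dfnorm s₁ x + t₂ * S.dfnorm s₂ x := by
  have habs := abs_add_le (t₁ * deriv (deriv s₁) (S.musq x)) (t₂ * deriv (deriv s₂) (S.musq x))
  rw [abs_mul, abs_mul, abs_of_nonneg ht₁, abs_of_nonneg ht₂] at habs
  unfold dfnorm
  rw [deriv_linear_combination h₁ h₂, deriv_linear_combination h₁' h₂']
  linarith [mul_le_mul_of_nonneg_right habs (S.dmusqnorm_nonneg x)]

end TamedData

theorem admissible_convex_cone (S : TamedData) (s₁ s₂ : ℝ → ℝ)
    (h₁ : S.Admissible s₁) (h₂ : S.Admissible s₂)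
    (t₁ t₂ : ℝ) (ht₁ : 0 < t₁) (ht₂ : 0 < t₂) :
    S.Admissible (fun r => t₁ * s₁ r + t₂ * s₂ r) := by
  obtain ⟨hs₁, hn₁, hp₁, hl₁⟩ := h₁
  obtain ⟨hs₂, hn₂, hp₂, hl₂⟩ := h₂
  have hd₁ : Differentiable ℝ s₁ := hs₁.differentiable (by simp)
  have hd₂ : Differentiable ℝ s₂ := hs₂.differentiable (by simp)
  have hd₁' : Differentiable ℝ (deriv s₁) :=
    (contDiff_infty_iff_deriv.1 hs₁).2.differentiable (by simp)
  have hd₂' : Differentiable ℝ (deriv s₂) :=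
    (contDiff_infty_iff_deriv.1 hs₂).2.differentiable (by simp)
  refine ⟨(contDiff_const.mul hs₁).add (contDiff_const.mul hs₂), fun r hr => ?_,
    fun r hr => ?_, ?_⟩
  · have := hn₁ r hr
    have := hn₂ r hr
    positivity
  · rw [deriv_linear_combination hd₁ hd₂]
    have := hp₁ r hr
    have := hp₂ r hr
    positivity
  rw [tendsto_atTop]
  intro b
  set c := max b 0
  have hc : 0 ≤ c := le_max_right _ _
  filter_upwards [hl₁.eventually_ge_atTop (c * (t₁ + 1) / t₁ ^ 2),
    hl₂.eventually_ge_atTop (c / t₂)] with x hx₁ hx₂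
  refine (le_max_left b 0).trans ?_
  have hv := S.vnorm_nonneg x
  have hν := S.nu_nonneg x
  have hf₁ : 0 < S.ffun s₁ x := hp₁ _ (S.musq_nonneg x)
  have hf₂ : 0 < S.ffun s₂ x := hp₂ _ (S.musq_nonneg x)
  have hg₁ := S.dfnorm_nonneg s₁ x
  have hg₂ := S.dfnorm_nonneg s₂ x
  have hg := S.dfnorm_nonneg (fun r => t₁ * s₁ r + t₂ * s₂ r) x
  have hle := mul_le_mul_of_nonneg_right
    (S.dfnorm_linear_combination_le hd₁ hd₂ hd₁' hd₂' ht₁.le ht₂.le x) hv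
  rw [S.ffun_linear_combination hd₁ hd₂]
  rw [le_div_iff₀ (by positivity), div_mul_eq_mul_div, div_le_iff₀ (by positivity)] at hx₁ hx₂
  rw [le_div_iff₀ (by positivity)]
  have hden : S.dfnorm (fun r => t₁ * s₁ r + t₂ * s₂ r) x * S.vnorm x +
      (t₁ * S.ffun s₁ x + t₂ * S.ffun s₂ x) * S.nu x + 1 ≤
      (t₁ + 1) * (S.dfnorm s₁ x * S.vnorm x + S.ffun s₁ x * S.nu x + 1) +
      t₂ * (S.dfnorm s₂ x * S.vnorm x + S.ffun s₂ x * S.nu x + 1) := by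
    have : 0 ≤ S.dfnorm s₁ x * S.vnorm x := by positivity
    have : 0 ≤ S.ffun s₁ x * S.nu x := by positivity
    linarith
  have hcross : 0 ≤ 2 * (t₁ * t₂) * (S.ffun s₁ x * S.ffun s₂ x) * S.vnorm x ^ 2 := by
    positivity
  have hx₂' := mul_le_mul_of_nonneg_left hx₂ ht₂.le
  linarith [mul_le_mul_of_nonneg_left hden hc]
end
end
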